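/- Let D ⊆ S^{d-1} be a finite set satisfying the moment conditions ∑_{x∈D} ⟨y,x⟩² = (|D|/d)⟨y,y⟩ and ∑_{x∈D} ⟨y,x⟩⁴ = (3|D|/(d(d+2)))⟨y,y⟩² for all y ∈ ℝ^d. If α ∈ ℝ^d satisfies ⟨α,x⟩ ∈ {0,±1} for all x ∈ D, then ⟨α,α⟩ = (d+2)/3, the number of x ∈ D with ⟨α,x⟩ = ±1 equals (d+2)|D|/(3d), and the number of x ∈ D with ⟨α,x⟩ = 0 equals 2(d-1)|D|/(3d). -/

import Mathlib

open scoped RealInnerProductSpace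

theorem stmt0 (d : ℕ) (hd : 1 ≤ d) (D : Finset (EuclideanSpace ℝ (Fin d)))
    (hD : D.Nonempty)
    (hunit : ∀ x ∈ D, ‖x‖ = 1)
    (h2 : ∀ y : EuclideanSpace ℝ (Fin d),
      ∑ x ∈ D, ⟪y, x⟫ ^ 2 = ((D.card : ℝ) / d) * ⟪y, y⟫)
    (h4 : ∀ y : EuclideanSpace ℝ (Fin d),
      ∑ x ∈ D, ⟪y, x⟫ ^ 4 = (3 * (D.card : ℝ) / (d * (d + 2))) * ⟪y, y⟫ ^ 2)
    (α : EuclideanSpace ℝ (Fin d)) (hα0 : α ≠ 0)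
    (hα : ∀ x ∈ D, ⟪α, x⟫ = 0 ∨ ⟪α, x⟫ = 1 ∨ ⟪α, x⟫ = -1) :
    ⟪α, α⟫ = ((d : ℝ) + 2) / 3 ∧
    ((D.filter fun x => ⟪α, x⟫ = 1 ∨ ⟪α, x⟫ = -1).card : ℝ)
      = ((d : ℝ) + 2) * D.card / (3 * d) ∧
    ((D.filter fun x => ⟪α, x⟫ = 0).card : ℝ)
      = 2 * ((d : ℝ) - 1) * D.card / (3 * d) := by
  have hd' : (0 : ℝ) < d := by exact_mod_cast hd
  have hcard : (0 : ℝ) < D.card := by exact_mod_cast hD.card_pos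
  have hnorm : (0 : ℝ) < ⟪α, α⟫ := real_inner_self_pos.mpr hα0
  have h2count : ∑ x ∈ D, ⟪α, x⟫ ^ 2
      = ((D.filter fun x => ⟪α, x⟫ = 1 ∨ ⟪α, x⟫ = -1).card : ℝ) := by
    rw [Finset.card_filter, Nat.cast_sum]
    refine Finset.sum_congr rfl fun x hx => ?_
    rcases hα x hx with h | h | h <;> norm_num [h]
  have h4eq : ∑ x ∈ D, ⟪α, x⟫ ^ 4 = ∑ x ∈ D, ⟪α, x⟫ ^ 2 := by
    refine Finset.sum_congr rfl fun x hx => ?_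
    rcases hα x hx with h | h | h <;> norm_num [h]
  have hsplit : ((D.filter fun x => ⟪α, x⟫ = 0).card : ℝ)
      + ((D.filter fun x => ⟪α, x⟫ = 1 ∨ ⟪α, x⟫ = -1).card : ℝ) = D.card := by
    rw [Finset.card_filter, Finset.card_filter, Finset.card_eq_sum_ones, Nat.cast_sum,
      Nat.cast_sum, Nat.cast_sum, ← Finset.sum_add_distrib]
    refine Finset.sum_congr rfl fun x hx => ?_
    rcases hα x hx with h | h | h <;> norm_num [h]
  have hα_sq : ⟪α, α⟫ = ((d : ℝ) + 2) / 3 := by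
    rw [h4 α, h2 α] at h4eq
    field_simp at h4eq
    linarith
  have hcount : ((D.filter fun x => ⟪α, x⟫ = 1 ∨ ⟪α, x⟫ = -1).card : ℝ)
      = ((d : ℝ) + 2) * D.card / (3 * d) := by
    rw [← h2count, h2 α, hα_sq]
    field_simp
  refine ⟨hα_sq, hcount, ?_⟩
  rw [eq_sub_of_add_eq hsplit, hcount]
  field_simp
  ring
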